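/- The L_NFU-sentence (∃n∈ℕ)(T(n) < n ∧ beth(n) ≠ ∅ ∧ beth(n) ≤ T⁴(|V|)) holds in every model of NFU^{-AC} ∪ {AxCount_≥, ¬AxCount}, where V is the universal set {x : x = x}, T⁴ denotes T applied four times, and κ ≤ μ means there are X ∈ κ and Y ∈ μ with an injection from X into Y. -/

import Mathlib

open FirstOrder Language

namespace NFUweak

/-! ## The language L_NFU -/

/-- Function symbols of `L_NFU`: a single binary (type-level) pairing function. -/
inductive NFUFunc : ℕ → Type
  | pair : NFUFunc 2

/-- Relation symbols of `L_NFU`: binary membership `∈` and unary sethood `S`. -/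
inductive NFURel : ℕ → Type
  | mem : NFURel 2
  | isSet : NFURel 1

/-- The language `L_NFU`. -/
def LNFU : Language := ⟨NFUFunc, NFURel⟩

/-- The membership relation symbol. -/
def memR : LNFU.Relations 2 := NFURel.mem

/-- The sethood relation symbol. -/
def setR : LNFU.Relations 1 := NFURel.isSet

/-- The pairing function symbol. -/
def pairF : LNFU.Functions 2 := NFUFunc.pair

/-! ## Stratification -/

/-- `termLevel σ t k` says that, relative to the assignment `σ` of levels (types)
to variables, the term `t` (and all of its subterms) receives level `k`. -/
def termLevel {α : Type} (σ : α → ℕ) : LNFU.Term α → ℕ → Prop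
  | Term.var v, k => σ v = k
  | Term.func _ ts, k => ∀ i, termLevel σ (ts i) k

/-- The stratification condition on an atomic formula `R(ts)`:
for `s ∈ t` the level of `t` is one more than that of `s`; `S(t)` imposes only
that `t` has a well-defined level. -/
def atomOK {α : Type} (σ : α → ℕ) : ∀ {l : ℕ}, LNFU.Relations l → (Fin l → LNFU.Term α) → Prop
  | _, NFURel.mem, ts => ∃ k, termLevel σ (ts 0) k ∧ termLevel σ (ts 1) (k + 1)
  | _, NFURel.isSet, ts => ∃ k, termLevel σ (ts 0) k

/-- `stratifiedFrom σ φ` : the formula `φ` is stratified, where the free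
variables receive the levels given by `σ` (each quantified variable may receive
any level). -/
def stratifiedFrom : ∀ {n : ℕ}, ((Empty ⊕ Fin n) → ℕ) → LNFU.BoundedFormula Empty n → Prop
  | _, _, BoundedFormula.falsum => True
  | _, σ, BoundedFormula.equal t s => ∃ k, termLevel σ t k ∧ termLevel σ s k
  | _, σ, BoundedFormula.rel R ts => atomOK σ R ts
  | _, σ, BoundedFormula.imp f g => stratifiedFrom σ f ∧ stratifiedFrom σ g
  | _, σ, BoundedFormula.all f =>
      ∃ k, stratifiedFrom
        (Sum.elim (fun e => σ (Sum.inl e)) (Fin.snoc (fun i => σ (Sum.inr i)) k)) f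

/-- A formula of `L_NFU` is stratified if some assignment of levels to its
variables witnesses the stratification conditions. -/
def IsStratified {n : ℕ} (φ : LNFU.BoundedFormula Empty n) : Prop :=
  ∃ σ, stratifiedFrom σ φ

/-! ## The axioms of NFU⁻ᴬᶜ -/

/-- Weak extensionality: sets with the same members are equal. -/
def weakExtAx : LNFU.Sentence :=
  ∀' ∀' ((setR.boundedFormula₁ &0 ⊓
          setR.boundedFormula₁ &1) ⟹
    (Term.bdEqual &0 &1 ⇔
      ∀' (memR.boundedFormula₂ &2 &0 ⇔
          memR.boundedFormula₂ &2 &1)))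

/-- The pairing axiom: `⟨x,y⟩ = ⟨w,z⟩ → x = w ∧ y = z`. -/
def pairingAx : LNFU.Sentence :=
  ∀' ∀' ∀' ∀' (Term.bdEqual
      (pairF.apply₂ &0 &1)
      (pairF.apply₂ &2 &3) ⟹
    (Term.bdEqual &0 &2 ⊓ Term.bdEqual &1 &3))

/-- The comprehension axiom for a formula `φ(x, z₀, …, z_{m-1})`, where the
variable `x` is (de Bruijn) variable `m` of `φ` and `z₀, …, z_{m-1}` are the
parameters: `∀ z⃗ ∃ y (S(y) ∧ ∀ x (x ∈ y ↔ φ(x, z⃗)))`. -/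
def comprehensionAx (m : ℕ) (φ : LNFU.BoundedFormula Empty (m + 1)) : LNFU.Sentence :=
  BoundedFormula.alls (∃'
    (setR.boundedFormula₁ (Term.var (Sum.inr ⟨m, by omega⟩)) ⊓
      ∀' (memR.boundedFormula₂
            (Term.var (Sum.inr ⟨m + 1, by omega⟩)) (Term.var (Sum.inr ⟨m, by omega⟩)) ⇔
          φ.liftAt 1 m)))

/-- The theory NFU⁻ᴬᶜ : weak extensionality, pairing and stratified comprehension. -/
def NFUmAC : LNFU.Theory :=
  {weakExtAx, pairingAx} ∪
    {s | ∃ (m : ℕ) (φ : LNFU.BoundedFormula Empty (m + 1)),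
      IsStratified φ ∧ s = comprehensionAx m φ}

/-- The axiom `∀x S(x)` ("everything is a set"), turning NFU⁻ᴬᶜ into NF. -/
def allSetAx : LNFU.Sentence :=
  ∀' (setR.boundedFormula₁ &0)

/-- The theory NF. -/
def NF : LNFU.Theory := NFUmAC ∪ {allSetAx}

end NFUweak
namespace NFUweak

/-! ## Semantic notions inside a model of NFU⁻ᴬᶜ -/

section Semantics

variable {M : Type} [LNFU.Structure M]

/-- The membership relation of the model. -/
def smem (x y : M) : Prop := Structure.RelMap memR ![x, y]

/-- The sethood predicate of the model. -/
def sset (x : M) : Prop := Structure.RelMap setR ![x]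

/-- The (type-level) pairing function of the model. -/
def spair (x y : M) : M := Structure.funMap pairF ![x, y]

/-- `s` is the singleton `{x}`. -/
def isSingletonOf (s x : M) : Prop := sset s ∧ ∀ z, smem z s ↔ z = x

/-- `e` is the empty set. -/
def isEmptySet (e : M) : Prop := sset e ∧ ∀ z, ¬ smem z e

/-- `v` is the universal set `V`. -/
def isUniverseOf (v : M) : Prop := sset v ∧ ∀ x, smem x v

/-- `f` is an internal function from (the members of) `X` to `Y`, coded as a set of
type-level ordered pairs `⟨a, b⟩`. -/
def isFunc (f X Y : M) : Prop :=
  sset f ∧ (∀ p, smem p f → ∃ a b, p = spair a b ∧ smem a X ∧ smem b Y) ∧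
    (∀ a, smem a X → ∃ b, smem (spair a b) f) ∧
    (∀ a b b', smem (spair a b) f → smem (spair a b') f → b = b')

/-- `f` is an internal injection from `X` into `Y`. -/
def isInjFunc (f X Y : M) : Prop :=
  isFunc f X Y ∧ ∀ a a' b, smem (spair a b) f → smem (spair a' b) f → a = a'

/-- `f` is an internal bijection between `X` and `Y`. -/
def isBijFunc (f X Y : M) : Prop :=
  isInjFunc f X Y ∧ ∀ b, smem b Y → ∃ a, smem (spair a b) f

/-- `X` and `Y` are equipollent (internally). -/
def equipollent (X Y : M) : Prop := ∃ f, isBijFunc f X Y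

/-- `c` is the cardinal `|X|`, i.e. the equivalence class of `X` under equipollence. -/
def isCardOf (c X : M) : Prop := sset c ∧ ∀ y, smem y c ↔ equipollent y X

/-- `c` is a cardinal. -/
def isCardinal (c : M) : Prop := ∃ X, sset X ∧ isCardOf c X

/-- `κ ≤ μ` for cardinals: some member of `κ` injects into some member of `μ`. -/
def cardLe (κ μ : M) : Prop := ∃ X Y f, smem X κ ∧ smem Y μ ∧ isInjFunc f X Y

/-- `Y = ι``X` is the set of singletons of members of `X`. -/
def isIotaImageOf (Y X : M) : Prop :=
  sset Y ∧ ∀ z, smem z Y ↔ ∃ x, smem x X ∧ isSingletonOf z x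

/-- `t = T(c)` for a cardinal `c`:  `T(|X|) = |ι``X|`. -/
def isTOf (t c : M) : Prop :=
  ∃ X Y, smem X c ∧ isIotaImageOf Y X ∧ isCardOf t Y

/-- `t = T⁴(c)`. -/
def isT4Of (t c : M) : Prop :=
  ∃ t₁ t₂ t₃, isTOf t₁ c ∧ isTOf t₂ t₁ ∧ isTOf t₃ t₂ ∧ isTOf t t₃

/-- `z` is the cardinal `0`, the set of all objects with no members. -/
def isZeroCard (z : M) : Prop := sset z ∧ ∀ y, smem y z ↔ ∀ w, ¬ smem w y

/-- `s = S(x)` is the cardinal successor:  `S(x) = {y : (∃z∈y)(y∖{z} ∈ x)}`. -/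
def isSuccOf (s x : M) : Prop :=
  sset s ∧ ∀ y, smem y s ↔
    ∃ z, smem z y ∧ ∃ d, sset d ∧ (∀ w, smem w d ↔ (smem w y ∧ w ≠ z)) ∧ smem d x

/-- `o` is the cardinal `1 = S(0)`. -/
def isOneCard (o : M) : Prop := ∃ z, isZeroCard z ∧ isSuccOf o z

/-- `I` is an inductive set: it contains `0` and is closed under `S`. -/
def isInductiveSet (I : M) : Prop :=
  sset I ∧ (∀ z, isZeroCard z → smem z I) ∧ ∀ a b, smem a I → isSuccOf b a → smem b I

/-- `n` is an internal natural number: it belongs to every inductive set. -/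
def isNat (n : M) : Prop := ∀ I, isInductiveSet I → smem n I

/-- `N` is the set `ℕ` of internal natural numbers. -/
def isNatSet (N : M) : Prop := sset N ∧ ∀ y, smem y N ↔ isNat y

/-- `m + k = n` on cardinals, via disjoint unions. -/
def cardAdd (m k n : M) : Prop :=
  ∃ x y u, smem x m ∧ smem y k ∧ (∀ w, ¬ (smem w x ∧ smem w y)) ∧
    sset u ∧ (∀ w, smem w u ↔ (smem w x ∨ smem w y)) ∧ smem u n

/-- `P` is the cartesian product `x × y` (with type-level pairs). -/
def isProdOf (P x y : M) : Prop :=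
  sset P ∧ ∀ p, smem p P ↔ ∃ a b, smem a x ∧ smem b y ∧ p = spair a b

/-- `k · m = n` on cardinals, via cartesian products. -/
def cardMul (k m n : M) : Prop :=
  ∃ x y P, smem x k ∧ smem y m ∧ isProdOf P x y ∧ smem P n

/-- `m ≤ n` on internal natural numbers: `∃k∈ℕ, m + k = n`. -/
def natLe (m n : M) : Prop := ∃ k, isNat k ∧ cardAdd m k n

/-- The model satisfies `AxCount₍≥₎ : (∀n∈ℕ)(T(n) ≤ n)`. -/
def axCountGeqHolds (M : Type) [LNFU.Structure M] : Prop :=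
  ∀ n : M, isNat n → ∀ t, isTOf t n → natLe t n

/-- The model satisfies `AxCount₍≤₎ : (∀n∈ℕ)(n ≤ T(n))`. -/
def axCountLeqHolds (M : Type) [LNFU.Structure M] : Prop :=
  ∀ n : M, isNat n → ∀ t, isTOf t n → natLe n t

/-- The model satisfies `AxCount : (∀n∈ℕ)(T(n) = n)`. -/
def axCountHolds (M : Type) [LNFU.Structure M] : Prop :=
  ∀ n : M, isNat n → ∀ t, isTOf t n → t = n

/-- The model satisfies the Axiom of Choice: every set of pairwise disjoint
nonempty sets has a transversal. -/
def acHolds (M : Type) [LNFU.Structure M] : Prop :=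
  ∀ X : M, sset X →
    (∀ y, smem y X → sset y ∧ ∃ z, smem z y) →
    (∀ y y', smem y X → smem y' X → y ≠ y' → ∀ z, ¬ (smem z y ∧ smem z y')) →
    ∃ t, sset t ∧ ∀ y, smem y X → ∃! z, smem z y ∧ smem z t

/-- `2^κ` is defined (i.e. `2^κ ≠ ∅`): there is a set `X` with `|ι``X| = κ`. -/
def twoPowDefined (κ : M) : Prop := ∃ X Y, isIotaImageOf Y X ∧ isCardOf κ Y

/-- `P` is the power set of `X`. -/
def isPowerSetOf (P X : M) : Prop :=
  sset P ∧ ∀ z, smem z P ↔ (sset z ∧ ∀ w, smem w z → smem w X)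

/-- `μ = 2^κ` (in the nonempty case): `μ = |P(X)|` for some `X` with `|ι``X| = κ`. -/
def isTwoPowOf (μ κ : M) : Prop :=
  ∃ X Y P, isIotaImageOf Y X ∧ isCardOf κ Y ∧ isPowerSetOf P X ∧ isCardOf μ P

/-- `f` is the internal function `beth : ℕ → NC ∪ {∅}` with `beth(0) = ℵ₀` and
`beth(n+1) = 2^{beth(n)}` (with value `∅` once undefined). -/
def isBethFun (f : M) : Prop :=
  sset f ∧
    (∀ p, smem p f → ∃ n y, isNat n ∧ p = spair n y) ∧
    (∀ n, isNat n → ∃ y, smem (spair n y) f) ∧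
    (∀ n y y', smem (spair n y) f → smem (spair n y') f → y = y') ∧
    (∀ z y, isZeroCard z → smem (spair z y) f → ∃ N, isNatSet N ∧ isCardOf y N) ∧
    (∀ n n' y y', isNat n → isSuccOf n' n →
      smem (spair n y) f → smem (spair n' y') f →
        ((isEmptySet y ∧ isEmptySet y') ∨
          (¬ isEmptySet y ∧
            (isTwoPowOf y' y ∨ (isEmptySet y' ∧ ¬ twoPowDefined y)))))

end Semantics

end NFUweak
namespace NFUweak

/-! ## BFEXTs and the structure ⟨BF, E⟩ inside a model of NFU⁻ᴬᶜ -/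

section BF

variable {M : Type} [LNFU.Structure M]

/-- `R` is an internal binary relation: a set of (type-level) ordered pairs. -/
def isRel (R : M) : Prop := sset R ∧ ∀ p, smem p R → ∃ x y, p = spair x y

/-- `x` belongs to the field `Dom(R) = dom(R) ∪ rng(R)` of the relation `R`. -/
def inField (x R : M) : Prop := ∃ y, smem (spair x y) R ∨ smem (spair y x) R

/-- `D` is the field `Dom(R)` of `R`, as a set. -/
def isFieldSetOf (D R : M) : Prop := sset D ∧ ∀ x, smem x D ↔ inField x R

/-- `R` is a BFEXT: a binary relation that is well-founded (every nonempty
subset of its field has an `R`-minimal element) and extensional. -/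
def isBFEXT (R : M) : Prop :=
  isRel R ∧
    (∀ B, sset B → (∃ b, smem b B) → (∀ b, smem b B → inField b R) →
      ∃ b, smem b B ∧ ∀ c, smem c B → ¬ smem (spair c b) R) ∧
    (∀ a b, inField a R → inField b R →
      (∀ c, smem (spair c a) R ↔ smem (spair c b) R) → a = b)

/-- `x` belongs to the smallest subset of `Dom(R)` containing `a` and closed
under `R`-predecessors. -/
def inSeg (x R a : M) : Prop :=
  ∀ B, sset B → (∀ b, smem b B → inField b R) → smem a B →
    (∀ b c, smem b B → smem (spair c b) R → smem c B) → smem x B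

/-- `s = seg_R(a)`: the restriction of `R` to the smallest subset of `Dom(R)`
containing `a` and closed under `R`-predecessors. -/
def isSegOf (s R a : M) : Prop :=
  sset s ∧ ∀ p, smem p s ↔
    (smem p R ∧ ∃ x y, p = spair x y ∧ inSeg x R a ∧ inSeg y R a)

/-- `R ∈ Ω`: `R` is a BFEXT with `R = seg_R(a)` for some `a ∈ Dom(R)`. -/
def inOmega (R : M) : Prop := isBFEXT R ∧ ∃ a, inField a R ∧ isSegOf R R a

/-- `a = 1_R` is the (unique) top of `R ∈ Ω`. -/
def isTopOf (a R : M) : Prop := inField a R ∧ isSegOf R R a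

/-- `f` is an internal isomorphism between the relations `R` and `S`. -/
def isIsoRel (f R S : M) : Prop :=
  sset f ∧
    (∀ p, smem p f → ∃ x y, p = spair x y ∧ inField x R ∧ inField y S) ∧
    (∀ x, inField x R → ∃ y, smem (spair x y) f) ∧
    (∀ x y y', smem (spair x y) f → smem (spair x y') f → y = y') ∧
    (∀ x x' y, smem (spair x y) f → smem (spair x' y) f → x = x') ∧
    (∀ y, inField y S → ∃ x, smem (spair x y) f) ∧
    (∀ x y x' y', smem (spair x x') f → smem (spair y y') f →
      (smem (spair x y) R ↔ smem (spair x' y') S))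

/-- `R` and `S` are isomorphic relations. -/
def relIso (R S : M) : Prop := ∃ f, isIsoRel f R S

/-- `t = [R]` is the set of all relations isomorphic to `R`. -/
def isTypeOf (t R : M) : Prop := sset t ∧ ∀ S, smem S t ↔ relIso S R

/-- `a ∈ BF`: `a = [R]` for some `R ∈ Ω`. -/
def inBF (a : M) : Prop := ∃ R, inOmega R ∧ isTypeOf a R

/-- `a E b` for `a, b ∈ BF`: for `R ∈ a`, `S ∈ b` there is `x ∈ Dom(S)` with
`⟨x, 1_S⟩ ∈ S` and `R ≅ seg_S(x)`. -/
def erel (a b : M) : Prop :=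
  ∃ R S, smem R a ∧ smem S b ∧
    ∃ x oneS, isTopOf oneS S ∧ smem (spair x oneS) S ∧
      ∃ sg, isSegOf sg S x ∧ relIso R sg

/-- `e` is the set `E ⊆ BF × BF`. -/
def isESet (e : M) : Prop :=
  sset e ∧ ∀ p, smem p e ↔ ∃ a b, p = spair a b ∧ inBF a ∧ inBF b ∧ erel a b

/-- `R' = T(R)`: the relation `{⟨{x},{y}⟩ : ⟨x,y⟩ ∈ R}`. -/
def isTRelOf (R' R : M) : Prop :=
  sset R' ∧ ∀ p, smem p R' ↔
    ∃ x y sx sy, smem (spair x y) R ∧ isSingletonOf sx x ∧ isSingletonOf sy y ∧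
      p = spair sx sy

/-- `t' = T(t)` for (isomorphism) types `t` of well-founded relations:
`T([R]) = [{⟨{x},{y}⟩ : ⟨x,y⟩ ∈ R}]`. -/
def isTTypeOf (t' t : M) : Prop :=
  ∃ R R', smem R t ∧ isTRelOf R' R ∧ isTypeOf t' R'

/-- `y = M₀ = E^ω`, the set of types of BFEXTs with finite domain. -/
def isM0Set (y : M) : Prop :=
  sset y ∧ ∀ a, smem a y ↔
    (inBF a ∧ ∃ R D c, smem R a ∧ isFieldSetOf D R ∧ isCardOf c D ∧ isNat c)

/-- `g` is the internal function `n ↦ M_n = E^{ω+n}` on the internal naturals: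
`M_0 = E^ω` and `M_{n+1} = {a ∈ BF : every E-predecessor of a lies in M_n}`. -/
def isMFun (g : M) : Prop :=
  sset g ∧
    (∀ p, smem p g → ∃ n y, isNat n ∧ p = spair n y) ∧
    (∀ n, isNat n → ∃ y, smem (spair n y) g) ∧
    (∀ n y y', smem (spair n y) g → smem (spair n y') g → y = y') ∧
    (∀ z y, isZeroCard z → smem (spair z y) g → isM0Set y) ∧
    (∀ n n' y y', isNat n → isSuccOf n' n →
      smem (spair n y) g → smem (spair n' y') g →
        (sset y' ∧ ∀ a, smem a y' ↔ (inBF a ∧ ∀ b, inBF b → erel b a → smem b y)))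

end BF

end NFUweak
namespace NFUweak

/-! ## The Simple Theory of Types with Infinity (TSTI) -/

/-- Formulae of the many-sorted language `L_TST`, with named variables:
`mem n i j` is `x^n_i ∈_n x^{n+1}_j`, `eq n i j` is `x^n_i = x^n_j`, and
`all n i φ` is `∀ x^n_i, φ`. -/
inductive TSTFormula : Type
  | mem (n i j : ℕ)
  | eq (n i j : ℕ)
  | fal
  | imp (φ ψ : TSTFormula)
  | all (n i : ℕ) (φ : TSTFormula)

/-- Update a many-sorted valuation at variable `x^n_i`. -/
def tstUpd {M : ℕ → Type} (v : ∀ n, ℕ → M n) (n i : ℕ) (a : M n) : ∀ m, ℕ → M m :=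
  fun m j => if h : m = n ∧ j = i then (congrArg M h.1).symm ▸ a else v m j

/-- Satisfaction of an `L_TST`-formula in the many-sorted structure `⟨M, E⟩`
under the valuation `v`. -/
def TSTFormula.Realize {M : ℕ → Type} (E : ∀ n, M n → M (n + 1) → Prop) :
    TSTFormula → (∀ n, ℕ → M n) → Prop
  | .mem n i j, v => E n (v n i) (v (n + 1) j)
  | .eq n i j, v => v n i = v n j
  | .fal, _ => False
  | .imp φ ψ, v => φ.Realize E v → ψ.Realize E v
  | .all n i φ, v => ∀ a : M n, φ.Realize E (tstUpd v n i a)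

/-- All sorts mentioned in the formula are `< k` (so it is an `L_k`-formula). -/
def TSTFormula.sortsLT : TSTFormula → ℕ → Prop
  | .mem n _ _, k => n + 1 < k
  | .eq n _ _, k => n < k
  | .fal, _ => True
  | .imp φ ψ, k => φ.sortsLT k ∧ ψ.sortsLT k
  | .all n _ φ, k => n < k ∧ φ.sortsLT k

/-- `p : M 2` is the Kuratowski ordered pair `⟨a, b⟩ = {{a},{a,b}}`. -/
def isKPair {M : ℕ → Type} (E : ∀ n, M n → M (n + 1) → Prop)
    (p : M 2) (a b : M 0) : Prop :=
  ∀ s : M 1, E 1 s p ↔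
    ((∀ z, E 0 z s ↔ z = a) ∨ (∀ z, E 0 z s ↔ (z = a ∨ z = b)))

/-- The axiom of Infinity: there are `x¹` and `f³` such that `f³` codes an
injective, non-surjective function from `x¹` to `x¹` (with Kuratowski pairs). -/
def TSTInfinity {M : ℕ → Type} (E : ∀ n, M n → M (n + 1) → Prop) : Prop :=
  ∃ (X : M 1) (f : M 3),
    (∀ p : M 2, E 2 p f → ∃ a b, E 0 a X ∧ E 0 b X ∧ isKPair E p a b) ∧
    (∀ a, E 0 a X → ∃ b p, E 0 b X ∧ E 2 p f ∧ isKPair E p a b) ∧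
    (∀ a b b' p p', E 2 p f → E 2 p' f → isKPair E p a b → isKPair E p' a b' → b = b') ∧
    (∀ a a' b p p', E 2 p f → E 2 p' f → isKPair E p a b → isKPair E p' a' b → a = a') ∧
    (∃ b, E 0 b X ∧ ∀ a p, E 2 p f → ¬ isKPair E p a b)

/-- `⟨M, E⟩` is a model of TSTI: all sorts are nonempty and Extensionality,
Comprehension (for every `L_TST`-formula) and Infinity hold. -/
def IsTSTIModel (M : ℕ → Type) (E : ∀ n, M n → M (n + 1) → Prop) : Prop :=
  (∀ n, Nonempty (M n)) ∧
    (∀ n, ∀ x y : M (n + 1), (∀ z, E n z x ↔ E n z y) → x = y) ∧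
    (∀ (φ : TSTFormula) (n i : ℕ) (v : ∀ m, ℕ → M m),
      ∃ y : M (n + 1), ∀ x : M n, E n x y ↔ φ.Realize E (tstUpd v n i x)) ∧
    TSTInfinity E

/-- `⟨M, E⟩` is a model of the fragment TSTI_k, which only refers to the sorts
`< k` (so `k ≥ 4` is needed for the axiom of Infinity to be expressible). -/
def IsTSTIModelBelow (k : ℕ) (M : ℕ → Type) (E : ∀ n, M n → M (n + 1) → Prop) : Prop :=
  (∀ n, n < k → Nonempty (M n)) ∧
    (∀ n, n + 1 < k → ∀ x y : M (n + 1), (∀ z, E n z x ↔ E n z y) → x = y) ∧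
    (∀ (φ : TSTFormula), φ.sortsLT k → ∀ (n i : ℕ), n + 1 < k →
      ∀ v : ∀ m, ℕ → M m,
        ∃ y : M (n + 1), ∀ x : M n, E n x y ↔ φ.Realize E (tstUpd v n i x)) ∧
    TSTInfinity E

/-! ## The language of arithmetic and the internal arithmetic of a model -/

/-- Function symbols of `L_PA`: `0`, `1`, `+` and `·`. -/
inductive PAFunc : ℕ → Type
  | zero : PAFunc 0
  | one : PAFunc 0
  | add : PAFunc 2
  | mul : PAFunc 2

/-- The language `L_PA` of arithmetic. -/
def LPA : Language := ⟨PAFunc, fun _ => Empty⟩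

/-- The type of internal natural numbers of a model of NFU⁻ᴬᶜ. -/
def NatSub (M : Type) [LNFU.Structure M] : Type := {n : M // isNat n}

/-- An `L_PA`-structure on the internal natural numbers of `M` is the internal
arithmetic if its operations are given by the internal graphs of `0`, `1`,
cardinal addition and cardinal multiplication. -/
def InternalArithOn (M : Type) [LNFU.Structure M] (A : LPA.Structure (NatSub M)) : Prop :=
  isZeroCard (A.funMap PAFunc.zero ![]).val ∧
    isOneCard (A.funMap PAFunc.one ![]).val ∧
    (∀ a b : NatSub M, cardAdd a.val b.val (A.funMap PAFunc.add ![a, b]).val) ∧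
    (∀ a b : NatSub M, cardMul a.val b.val (A.funMap PAFunc.mul ![a, b]).val)

/-- `φ^ℕ` holds in `M`: the sentence `φ` of `L_PA` is true in the internal
arithmetic `⟨ℕ, +, ·, 0, 1⟩` of `M`. -/
def internalPASat (M : Type) [LNFU.Structure M] (φ : LPA.Sentence) : Prop :=
  ∀ A : LPA.Structure (NatSub M), InternalArithOn M A →
    @Sentence.Realize LPA (NatSub M) A φ

end NFUweak
namespace NFUweak

/-! ## Stratified definability -/

section Strat

variable {M : Type} [LNFU.Structure M]

/-- Level assignment on `Empty ⊕ Fin n` induced by one on `Fin n`. -/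
def lev {n : ℕ} (τ : Fin n → ℕ) : Empty ⊕ Fin n → ℕ := Sum.elim Empty.elim τ

/-- The term-function `t` is definable at level `k`, with parameters. -/
def TDef {n : ℕ} (σ : Fin n → ℕ) (k : ℕ) (t : (Fin n → M) → M) : Prop :=
  ∃ L : List (M × ℕ), ∀ (m : ℕ) (z : Fin m → M × ℕ), (∀ p ∈ L, ∃ i, z i = p) →
    ∃ s : LNFU.Term (Empty ⊕ Fin (m + n)),
      termLevel (lev (Fin.append (fun i => (z i).2) σ)) s k ∧
      ∀ v, s.realize (Sum.elim default (Fin.append (fun i => (z i).1) v)) = t v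

/-- The predicate `P` is definable by a stratified formula, with parameters. -/
def SDef {n : ℕ} (σ : Fin n → ℕ) (P : (Fin n → M) → Prop) : Prop :=
  ∃ L : List (M × ℕ), ∀ (m : ℕ) (z : Fin m → M × ℕ), (∀ p ∈ L, ∃ i, z i = p) →
    ∃ φ : LNFU.BoundedFormula Empty (m + n),
      stratifiedFrom (lev (Fin.append (fun i => (z i).2) σ)) φ ∧
      ∀ v, φ.Realize default (Fin.append (fun i => (z i).1) v) ↔ P v

theorem termLevel_relabel {α β : Type} (g : α → β) (σ : β → ℕ) (t : LNFU.Term α) (k : ℕ) :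
    termLevel σ (t.relabel g) k ↔ termLevel (σ ∘ g) t k := by
  induction t with
  | var v => simp [Term.relabel, termLevel]
  | func f ts ih => simp [Term.relabel, termLevel, ih]

variable {n : ℕ} {σ : Fin n → ℕ} {k : ℕ}

theorem TDef.const (a : M) : TDef σ k (fun _ => a) := by
  refine ⟨[(a, k)], fun m z h => ?_⟩
  obtain ⟨i, hi⟩ := h (a, k) (by simp)
  exact ⟨Term.var (Sum.inr (Fin.castAdd n i)), by simp [termLevel, lev, hi], by simp [hi]⟩

theorem TDef.last : TDef (M := M) (Fin.snoc (α := fun _ => ℕ) σ k) k (fun w => w (Fin.last n)) := by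
  refine ⟨[], fun m z h => ?_⟩
  refine ⟨Term.var (Sum.inr (Fin.natAdd m (Fin.last n))), ?_, ?_⟩
  · simp only [termLevel, lev, Sum.elim_inr, Fin.append_right, Fin.snoc_last]
  · intro v
    simp only [Term.realize_var, Sum.elim_inr, Fin.append_right]

theorem append_castSucc {α : Type} {m n : ℕ} (a : Fin m → α) (w : Fin (n + 1) → α) (i : Fin (m + n)) :
    Fin.append a w (i.castSucc : Fin (m + n + 1)) = Fin.append a (fun i => w i.castSucc) i := by
  refine Fin.addCases (fun i => ?_) (fun i => ?_) i
  · rw [Fin.append_left]; exact Fin.append_left a w i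
  · rw [Fin.append_right]; exact Fin.append_right a w i.castSucc

theorem append_snoc' {α : Type} {m n : ℕ} (a : Fin m → α) (w : Fin n → α) (x : α) :
    Fin.append a (Fin.snoc (α := fun _ => α) w x) =
      Fin.snoc (α := fun _ => α) (n := m + n) (Fin.append a w) x :=
  Fin.append_snoc a w x

theorem TDef.w {t : (Fin n → M) → M} {j : ℕ} (h : TDef σ k t) :
    TDef (Fin.snoc (α := fun _ => ℕ) σ j) k (fun w => t (fun i => w i.castSucc)) := by
  obtain ⟨L, hL⟩ := h
  refine ⟨L, fun m z h => ?_⟩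
  obtain ⟨s, hs, hv⟩ := hL m z h
  refine ⟨s.relabel (Sum.map id (Fin.castSucc (n := m + n))), ?_, ?_⟩
  · rw [termLevel_relabel]
    convert hs using 1
    funext i
    rcases i with e | i
    · exact e.elim
    · simp only [Function.comp, lev, Sum.map_inr, Sum.elim_inr]
      rw [append_castSucc]
      simp only [Fin.snoc_castSucc]
  · intro v
    rw [Term.realize_relabel]
    refine Eq.trans ?_ (hv _)
    congr 1
    funext i
    rcases i with e | i
    · exact e.elim
    · simp only [Function.comp, Sum.map_inr, Sum.elim_inr]
      rw [append_castSucc]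

theorem TDef.pair {s t : (Fin n → M) → M} (hs : TDef σ k s) (ht : TDef σ k t) :
    TDef σ k (fun v => spair (s v) (t v)) := by
  obtain ⟨L, hL⟩ := hs
  obtain ⟨L', hL'⟩ := ht
  refine ⟨L ++ L', fun m z h => ?_⟩
  obtain ⟨s, hs, hv⟩ := hL m z (fun p hp => h p (by simp [hp]))
  obtain ⟨s', hs', hv'⟩ := hL' m z (fun p hp => h p (by simp [hp]))
  refine ⟨pairF.apply₂ s s', ?_, ?_⟩
  · simp only [Functions.apply₂, termLevel]
    intro i
    fin_cases i
    · exact hs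
    · exact hs'
  · intro v
    simp only [Term.realize_functions_apply₂, hv, hv', spair]

theorem SDef.mem {s t : (Fin n → M) → M} (hs : TDef σ k s) (ht : TDef σ (k + 1) t) :
    SDef σ (fun v => smem (s v) (t v)) := by
  obtain ⟨L, hL⟩ := hs
  obtain ⟨L', hL'⟩ := ht
  refine ⟨L ++ L', fun m z h => ?_⟩
  obtain ⟨s, hs, hv⟩ := hL m z (fun p hp => h p (by simp [hp]))
  obtain ⟨s', hs', hv'⟩ := hL' m z (fun p hp => h p (by simp [hp]))
  refine ⟨memR.boundedFormula₂ s s', ?_, ?_⟩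
  · exact ⟨k, hs, hs'⟩
  · intro v
    rw [BoundedFormula.realize_rel₂, hv, hv']
    rfl

theorem SDef.sset {s : (Fin n → M) → M} (hs : TDef σ k s) :
    SDef σ (fun v => sset (s v)) := by
  obtain ⟨L, hL⟩ := hs
  refine ⟨L, fun m z h => ?_⟩
  obtain ⟨s, hs, hv⟩ := hL m z h
  refine ⟨setR.boundedFormula₁ s, ?_, ?_⟩
  · exact ⟨k, hs⟩
  · intro v
    rw [BoundedFormula.realize_rel₁, hv]
    rfl

theorem SDef.eq {s t : (Fin n → M) → M} (hs : TDef σ k s) (ht : TDef σ k t) :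
    SDef σ (fun v => s v = t v) := by
  obtain ⟨L, hL⟩ := hs
  obtain ⟨L', hL'⟩ := ht
  refine ⟨L ++ L', fun m z h => ?_⟩
  obtain ⟨s, hs, hv⟩ := hL m z (fun p hp => h p (by simp [hp]))
  obtain ⟨s', hs', hv'⟩ := hL' m z (fun p hp => h p (by simp [hp]))
  refine ⟨Term.bdEqual s s', ?_, ?_⟩
  · exact ⟨k, hs, hs'⟩
  · intro v
    rw [BoundedFormula.realize_bdEqual, hv, hv']

theorem SDef.fal : SDef (M := M) σ (fun _ => False) :=
  ⟨[], fun _ _ _ => ⟨⊥, trivial, fun _ => Iff.rfl⟩⟩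

theorem SDef.imp {P Q : (Fin n → M) → Prop} (hs : SDef σ P) (ht : SDef σ Q) :
    SDef σ (fun v => P v → Q v) := by
  obtain ⟨L, hL⟩ := hs
  obtain ⟨L', hL'⟩ := ht
  refine ⟨L ++ L', fun m z h => ?_⟩
  obtain ⟨s, hs, hv⟩ := hL m z (fun p hp => h p (by simp [hp]))
  obtain ⟨s', hs', hv'⟩ := hL' m z (fun p hp => h p (by simp [hp]))
  refine ⟨s.imp s', ⟨hs, hs'⟩, ?_⟩
  intro v
  rw [BoundedFormula.realize_imp, hv, hv']

theorem SDef.all (k : ℕ) {Q : (Fin n → M) → M → Prop}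
    (h : SDef (Fin.snoc (α := fun _ => ℕ) σ k)
      (fun w => Q (fun i => w i.castSucc) (w (Fin.last n)))) :
    SDef σ (fun v => ∀ x, Q v x) := by
  obtain ⟨L, hL⟩ := h
  refine ⟨L, fun m z h => ?_⟩
  obtain ⟨s, hs, hv⟩ := hL m z h
  refine ⟨BoundedFormula.all (n := m + n) s, ⟨k, ?_⟩, ?_⟩
  · rw [append_snoc'] at hs
    exact hs
  · intro v
    rw [BoundedFormula.realize_all]
    refine forall_congr' fun x => ?_
    have := hv (Fin.snoc (α := fun _ => M) v x)
    rw [append_snoc'] at this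
    simpa using this

theorem SDef.congr {P Q : (Fin n → M) → Prop} (h : SDef σ P) (e : ∀ v, P v ↔ Q v) : SDef σ Q := by
  have : P = Q := funext fun v => propext (e v)
  exact this ▸ h

theorem SDef.not {P : (Fin n → M) → Prop} (h : SDef σ P) : SDef σ (fun v => ¬ P v) :=
  h.imp .fal

theorem SDef.and {P Q : (Fin n → M) → Prop} (hs : SDef σ P) (ht : SDef σ Q) :
    SDef σ (fun v => P v ∧ Q v) :=
  (hs.imp ht.not).not.congr fun v => by tauto

theorem SDef.or {P Q : (Fin n → M) → Prop} (hs : SDef σ P) (ht : SDef σ Q) :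
    SDef σ (fun v => P v ∨ Q v) :=
  (hs.not.imp ht).congr fun v => by tauto

theorem SDef.iff {P Q : (Fin n → M) → Prop} (hs : SDef σ P) (ht : SDef σ Q) :
    SDef σ (fun v => P v ↔ Q v) :=
  ((hs.imp ht).and (ht.imp hs)).congr fun v => by tauto

theorem SDef.ex (k : ℕ) {Q : (Fin n → M) → M → Prop}
    (h : SDef (Fin.snoc (α := fun _ => ℕ) σ k)
      (fun w => Q (fun i => w i.castSucc) (w (Fin.last n)))) :
    SDef σ (fun v => ∃ x, Q v x) :=
  (SDef.all k (Q := fun v x => ¬ Q v x) h.not).not.congr fun v => by simp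

/-- Unary predicates stratified at level `k`. -/
def St1 (k : ℕ) (P : M → Prop) : Prop :=
  ∀ {n : ℕ} {σ : Fin n → ℕ} {a : (Fin n → M) → M}, TDef σ k a → SDef σ (fun v => P (a v))

/-- Binary predicates stratified at levels `k`, `l`. -/
def St2 (k l : ℕ) (R : M → M → Prop) : Prop :=
  ∀ {n : ℕ} {σ : Fin n → ℕ} {a b : (Fin n → M) → M}, TDef σ k a → TDef σ l b →
    SDef σ (fun v => R (a v) (b v))

theorem comprehension (hM : M ⊨ NFUmAC) {k : ℕ} {P : M → Prop} (h : St1 k P) :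
    ∃ y, sset y ∧ ∀ x, smem x y ↔ P x := by
  obtain ⟨L, hL⟩ := h (n := 1) (σ := fun _ => k) (a := fun w => w 0)
    ⟨[], fun m z h => ⟨Term.var (Sum.inr (Fin.natAdd m 0)), by simp [termLevel, lev],
      by simp⟩⟩
  obtain ⟨φ, hs, hv⟩ := hL L.length L.get (fun p hp => by
    obtain ⟨i, hi⟩ := List.get_of_mem hp
    exact ⟨i, hi⟩)
  have hc := hM.realize_of_mem (comprehensionAx L.length φ)
    (Or.inr ⟨_, φ, ⟨_, hs⟩, rfl⟩)
  rw [comprehensionAx, Sentence.Realize, BoundedFormula.realize_alls] at hc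
  have h2 := hc (fun i => (L.get i).1)
  rw [BoundedFormula.realize_ex] at h2
  obtain ⟨y, hy⟩ := h2
  rw [BoundedFormula.realize_inf, BoundedFormula.realize_all] at hy
  refine ⟨y, ?_, fun x => ?_⟩
  · have := hy.1
    rw [BoundedFormula.realize_rel₁] at this
    convert this using 1
    simp [sset, Fin.snoc]
  · have := hy.2 x
    rw [BoundedFormula.realize_iff, BoundedFormula.realize_rel₂,
      BoundedFormula.realize_liftAt_one (by omega)] at this
    have h3 := hv (fun _ => x)
    refine Iff.trans ?_ h3
    convert this using 1
    · simp [smem, Fin.snoc]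
    · have e : ∀ u w : Fin (L.length + 1) → M, u = w → 
        (φ.Realize default u = φ.Realize default w) := by rintro u _ rfl; rfl
      refine iff_of_eq (e _ _ ?_)
      funext i
      refine Fin.lastCases ?_ (fun i => ?_) i
      · have := Fin.append_right (fun i => (L.get i).1) (fun _ : Fin 1 => x) 0
        refine this.trans ?_
        simp [Fin.snoc]
      · have := Fin.append_left (fun i => (L.get i).1) (fun _ : Fin 1 => x) i
        refine this.trans ?_
        simp [Fin.snoc]

theorem ext (hM : M ⊨ NFUmAC) {x y : M} (hx : sset x) (hy : sset y)
    (h : ∀ z, smem z x ↔ smem z y) : x = y := by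
  have hc := hM.realize_of_mem weakExtAx (Or.inl (Or.inl rfl))
  simp [weakExtAx, Sentence.Realize, Formula.Realize, Fin.snoc] at hc
  exact (hc x y hx hy).2 h

theorem spair_inj (hM : M ⊨ NFUmAC) {x y w z : M} (h : spair x y = spair w z) : x = w ∧ y = z := by
  have hc := hM.realize_of_mem pairingAx (Or.inl (Or.inr rfl))
  simp [pairingAx, Sentence.Realize, Formula.Realize, Fin.snoc] at hc
  exact hc x y w z h

end Strat

end NFUweak
namespace NFUweak

section Strat2

variable {M : Type} [LNFU.Structure M]

/-! ### Stratification of the basic notions -/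

theorem st_singleton (k : ℕ) : St2 (M := M) (k + 1) k isSingletonOf := fun hs hx =>
  .and (.sset hs) (.all k (.iff (.mem .last hs.w) (.eq .last hx.w)))

theorem st_empty (k : ℕ) : St1 (M := M) (k + 1) isEmptySet := fun hs =>
  .and (.sset hs) (.all k (.not (.mem .last hs.w)))

section
variable {n : ℕ} {σ : Fin n → ℕ} {k : ℕ} {f X Y : (Fin n → M) → M}

theorem sd_func (hf : TDef σ (k + 1) f) (hX : TDef σ (k + 1) X) (hY : TDef σ (k + 1) Y) :
    SDef σ (fun v => isFunc (f v) (X v) (Y v)) :=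
  .and (.sset hf) (.and
    (.all k (.imp (.mem .last hf.w) (.ex k (.ex k (.and
      (.eq TDef.last.w.w (.pair TDef.last.w .last))
      (.and (.mem TDef.last.w hX.w.w.w) (.mem .last hY.w.w.w)))))))
    (.and
      (.all k (.imp (.mem .last hX.w) (.ex k (.mem (.pair TDef.last.w .last) hf.w.w))))
      (.all k (.all k (.all k (.imp (.mem (.pair TDef.last.w.w TDef.last.w) hf.w.w.w)
        (.imp (.mem (.pair TDef.last.w.w TDef.last) hf.w.w.w) (.eq TDef.last.w .last))))))))

theorem sd_injFunc (hf : TDef σ (k + 1) f) (hX : TDef σ (k + 1) X) (hY : TDef σ (k + 1) Y) :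
    SDef σ (fun v => isInjFunc (f v) (X v) (Y v)) :=
  .and (sd_func hf hX hY)
      (.all k (.all k (.all k (.imp (.mem (.pair TDef.last.w.w TDef.last) hf.w.w.w)
        (.imp (.mem (.pair TDef.last.w TDef.last) hf.w.w.w) (.eq TDef.last.w.w TDef.last.w))))))

theorem sd_bijFunc (hf : TDef σ (k + 1) f) (hX : TDef σ (k + 1) X) (hY : TDef σ (k + 1) Y) :
    SDef σ (fun v => isBijFunc (f v) (X v) (Y v)) :=
  .and (sd_injFunc hf hX hY)
      (.all k (.imp (.mem .last hY.w) (.ex k (.mem (.pair .last TDef.last.w) hf.w.w))))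
end

theorem st_equip (k : ℕ) : St2 (M := M) (k + 1) (k + 1) equipollent := fun hX hY =>
  .ex (k + 1) (sd_bijFunc .last hX.w hY.w)

theorem st_card (k : ℕ) : St2 (M := M) (k + 2) (k + 1) isCardOf := fun hc hX =>
  .and (.sset hc) (.all (k + 1) (.iff (.mem .last hc.w) (st_equip k .last hX.w)))

theorem st_iota (k : ℕ) : St2 (M := M) (k + 2) (k + 1) isIotaImageOf := fun hY hX =>
  .and (.sset hY) (.all (k + 1) (.iff (.mem .last hY.w)
    (.ex k (.and (.mem .last hX.w.w) (st_singleton k TDef.last.w .last)))))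

theorem st_T (k : ℕ) : St2 (M := M) (k + 3) (k + 2) isTOf := fun ht hc =>
  .ex (k + 1) (.ex (k + 2) (.and (.mem TDef.last.w hc.w.w)
    (.and (st_iota k .last TDef.last.w) (st_card (k + 1) ht.w.w .last))))

theorem st_zero (k : ℕ) : St1 (M := M) (k + 2) isZeroCard := fun hz =>
  .and (.sset hz) (.all (k + 1) (.iff (.mem .last hz.w) (.all k (.not (.mem .last TDef.last.w)))))

theorem st_succ (k : ℕ) : St2 (M := M) (k + 2) (k + 2) isSuccOf := fun hs hx =>
  .and (.sset hs) (.all (k + 1) (.iff (.mem .last hs.w) (.ex k (.and (.mem .last TDef.last.w)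
    (.ex (k + 1) (.and (.sset .last) (.and
      (.all k (.iff (.mem .last TDef.last.w)
        (.and (.mem .last TDef.last.w.w.w) (.not (.eq .last TDef.last.w.w)))))
      (.mem .last hx.w.w.w))))))))

theorem st_inductive (k : ℕ) : St1 (M := M) (k + 3) isInductiveSet := fun hI =>
  .and (.sset hI) (.and (.all (k + 2) (.imp (st_zero k .last) (.mem .last hI.w)))
    (.all (k + 2) (.all (k + 2) (.imp (.mem TDef.last.w hI.w.w)
      (.imp (st_succ k .last TDef.last.w) (.mem .last hI.w.w))))))

theorem st_nat (k : ℕ) : St1 (M := M) (k + 2) isNat := fun hn =>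
  .all (k + 3) (.imp (st_inductive k .last) (.mem hn.w .last))

/-! ### Basic set existence -/


theorem ex_singleton (hM : M ⊨ NFUmAC) (x : M) : ∃ s, isSingletonOf s x :=
  comprehension hM (k := 0) (P := fun z => z = x) fun h => .eq h (.const x)

theorem ex_iota (hM : M ⊨ NFUmAC) (X : M) : ∃ Y, isIotaImageOf Y X :=
  comprehension hM (k := 1) (P := fun z => ∃ x, smem x X ∧ isSingletonOf z x) fun h =>
    .ex 0 (.and (.mem .last (.const X)) (st_singleton 0 h.w .last))

theorem ex_card (hM : M ⊨ NFUmAC) (X : M) : ∃ c, isCardOf c X :=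
  comprehension hM (k := 1) (P := fun z => equipollent z X) fun h => st_equip 0 h (.const X)

theorem ex_power (hM : M ⊨ NFUmAC) (X : M) : ∃ P, isPowerSetOf P X :=
  comprehension hM (k := 1) (P := fun z => sset z ∧ ∀ w, smem w z → smem w X) fun h =>
    .and (.sset h) (.all 0 (.imp (.mem .last h.w) (.mem .last (.const X))))

theorem ex_zero (hM : M ⊨ NFUmAC) : ∃ z : M, isZeroCard z :=
  comprehension hM (k := 1) (P := fun y => ∀ w, ¬ smem w y) fun h =>
    .all 0 (.not (.mem .last h.w))

theorem ex_diff (hM : M ⊨ NFUmAC) (y z : M) : ∃ d, sset d ∧ ∀ w, smem w d ↔ (smem w y ∧ w ≠ z) :=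
  comprehension hM (k := 0) (P := fun w => smem w y ∧ w ≠ z) fun h =>
    .and (.mem h (.const y)) (.not (.eq h (.const z)))

theorem ex_insert (hM : M ⊨ NFUmAC) (y z : M) : ∃ d, sset d ∧ ∀ w, smem w d ↔ (smem w y ∨ w = z) :=
  comprehension hM (k := 0) (P := fun w => smem w y ∨ w = z) fun h =>
    .or (.mem h (.const y)) (.eq h (.const z))

theorem ex_succ (hM : M ⊨ NFUmAC) (x : M) : ∃ s, isSuccOf s x :=
  comprehension hM (k := 1) (P := fun y => ∃ z, smem z y ∧ ∃ d, sset d ∧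
      (∀ w, smem w d ↔ (smem w y ∧ w ≠ z)) ∧ smem d x) fun h =>
   (.ex 0 (.and (.mem .last h.w)
    (.ex 1 (.and (.sset .last) (.and
      (.all 0 (.iff (.mem .last TDef.last.w)
        (.and (.mem .last h.w.w.w) (.not (.eq .last TDef.last.w.w)))))
      (.mem .last (.const x)))))))

theorem ex_natSet (hM : M ⊨ NFUmAC) : ∃ N : M, isNatSet N :=
  comprehension hM (k := 2) (P := isNat) (st_nat 0)

theorem nat_zero {z : M} (h : isZeroCard z) : isNat z := fun _ hI => hI.2.1 z h

theorem nat_succ {a b : M} (h : isNat a) (hb : isSuccOf b a) : isNat b :=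
  fun I hI => hI.2.2 a b (h I hI) hb

theorem nat_induction (hM : M ⊨ NFUmAC) {k : ℕ} {P : M → Prop} (hP : St1 k P) (h0 : ∀ z, isZeroCard z → P z)
    (hS : ∀ a b, isNat a → P a → isSuccOf b a → P b) {x : M} (hx : isNat x) : P x := by
  obtain ⟨I, hI, hI'⟩ := comprehension hM (P := fun a => P a) hP
  obtain ⟨N, hN, hN'⟩ := ex_natSet hM
  obtain ⟨J, hJ, hJ'⟩ := comprehension hM (k := 0) (P := fun a => smem a I ∧ smem a N) fun h =>
    .and (.mem h (.const I)) (.mem h (.const N))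
  have := hx J ⟨hJ, fun z hz => (hJ' z).2 ⟨(hI' z).2 (h0 z hz), (hN' z).2 (nat_zero hz)⟩,
    fun a b ha hb => ?_⟩
  · exact (hI' x).1 ((hJ' x).1 this).1
  · have ha' := (hJ' a).1 ha
    have h1 := (hN' a).1 ha'.2
    exact (hJ' b).2 ⟨(hI' b).2 (hS a b h1 ((hI' a).1 ha'.1) hb), (hN' b).2 (nat_succ h1 hb)⟩

/-! ### Building injections and bijections -/

theorem mk_inj (hM : M ⊨ NFUmAC) {k : ℕ} {R : M → M → Prop} (hR : St2 k k R) {X Y : M}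
    (tot : ∀ a, smem a X → ∃ b, smem b Y ∧ R a b)
    (fn : ∀ a b b', smem a X → smem b Y → smem b' Y → R a b → R a b' → b = b')
    (inj : ∀ a a' b, smem a X → smem a' X → smem b Y → R a b → R a' b → a = a') :
    ∃ f, isInjFunc f X Y ∧ ∀ a b, smem (spair a b) f ↔ (smem a X ∧ smem b Y ∧ R a b) := by
  obtain ⟨f, hf, hf'⟩ := comprehension hM (k := k)
    (P := fun p => ∃ a b, p = spair a b ∧ smem a X ∧ smem b Y ∧ R a b) fun h =>
    .ex k (.ex k (.and (.eq h.w.w (.pair TDef.last.w .last))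
      (.and (.mem TDef.last.w (.const X)) (.and (.mem .last (.const Y)) (hR TDef.last.w .last)))))
  have key : ∀ a b, smem (spair a b) f ↔ (smem a X ∧ smem b Y ∧ R a b) := by
    intro a b
    rw [hf']
    constructor
    · rintro ⟨a', b', h, h1⟩
      obtain ⟨rfl, rfl⟩ := spair_inj hM h
      exact h1
    · intro h
      exact ⟨a, b, rfl, h⟩
  refine ⟨f, ⟨⟨hf, ?_, ?_, ?_⟩, ?_⟩, key⟩
  · intro p hp
    obtain ⟨a, b, h, h1, h2, -⟩ := (hf' p).1 hp
    exact ⟨a, b, h, h1, h2⟩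
  · intro a ha
    obtain ⟨b, hb, hr⟩ := tot a ha
    exact ⟨b, (key a b).2 ⟨ha, hb, hr⟩⟩
  · intro a b b' h h'
    rw [key] at h h'
    exact fn a b b' h.1 h.2.1 h'.2.1 h.2.2 h'.2.2
  · intro a b b' h h'
    rw [key] at h h'
    exact inj a b b' h.1 h'.1 h.2.1 h.2.2 h'.2.2

theorem mk_bij (hM : M ⊨ NFUmAC) {k : ℕ} {R : M → M → Prop} (hR : St2 k k R) {X Y : M}
    (tot : ∀ a, smem a X → ∃ b, smem b Y ∧ R a b)
    (fn : ∀ a b b', smem a X → smem b Y → smem b' Y → R a b → R a b' → b = b')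
    (inj : ∀ a a' b, smem a X → smem a' X → smem b Y → R a b → R a' b → a = a')
    (sur : ∀ b, smem b Y → ∃ a, smem a X ∧ R a b) : equipollent X Y := by
  obtain ⟨f, hf, key⟩ := mk_inj hM hR tot fn inj
  refine ⟨f, hf, fun b hb => ?_⟩
  obtain ⟨a, ha, hr⟩ := sur b hb
  exact ⟨a, (key a b).2 ⟨ha, hb, hr⟩⟩

/-- Unpack an internal injection. -/
theorem inj_mem (hM : M ⊨ NFUmAC) {f X Y a b : M} (h : isInjFunc f X Y) (hab : smem (spair a b) f) :
    smem a X ∧ smem b Y := by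
  obtain ⟨a', b', e, h1, h2⟩ := h.1.2.1 _ hab
  obtain ⟨rfl, rfl⟩ := spair_inj hM e
  exact ⟨h1, h2⟩

/-- Equality of extensions gives equipollence. -/
theorem equip_of_ext (hM : M ⊨ NFUmAC) {X Y : M} (h : ∀ z, smem z X ↔ smem z Y) : equipollent X Y :=
  mk_bij hM (k := 0) (R := fun a b => a = b) (fun ha hb => .eq ha hb)
    (fun a ha => ⟨a, (h a).1 ha, rfl⟩) (fun a b b' _ _ _ h h' => h.symm.trans h')
    (fun a b b' _ _ _ h h' => h.trans h'.symm) (fun b hb => ⟨b, (h b).2 hb, rfl⟩)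

theorem equip_refl (hM : M ⊨ NFUmAC) (X : M) : equipollent X X := equip_of_ext hM fun _ => Iff.rfl

theorem equip_symm (hM : M ⊨ NFUmAC) {X Y : M} (h : equipollent X Y) : equipollent Y X := by
  obtain ⟨f, hf, hs⟩ := h
  refine mk_bij hM (k := 0) (R := fun a b => smem (spair b a) f)
    (fun ha hb => .mem (.pair hb ha) (.const f)) ?_ ?_ ?_ ?_
  · intro b hb
    obtain ⟨a, ha⟩ := hs b hb
    exact ⟨a, (inj_mem hM hf ha).1, ha⟩
  · intro a b b' _ _ _ h h'
    exact hf.2 _ _ _ h h'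
  · intro a b b' _ _ _ h h'
    exact hf.1.2.2.2 _ _ _ h h'
  · intro a ha
    obtain ⟨b, hb⟩ := hf.1.2.2.1 a ha
    exact ⟨b, (inj_mem hM hf hb).2, hb⟩

theorem equip_trans (hM : M ⊨ NFUmAC) {X Y Z : M} (h : equipollent X Y) (h' : equipollent Y Z) :
    equipollent X Z := by
  obtain ⟨f, hf, hs⟩ := h
  obtain ⟨g, hg, ht⟩ := h'
  refine mk_bij hM (k := 0) (R := fun a c => ∃ b, smem (spair a b) f ∧ smem (spair b c) g)
    (fun ha hb => .ex 0 (.and (.mem (.pair ha.w .last) (.const f))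
      (.mem (.pair .last hb.w) (.const g)))) ?_ ?_ ?_ ?_
  · intro a ha
    obtain ⟨b, hb⟩ := hf.1.2.2.1 a ha
    obtain ⟨c, hc⟩ := hg.1.2.2.1 b (inj_mem hM hf hb).2
    exact ⟨c, (inj_mem hM hg hc).2, b, hb, hc⟩
  · rintro a c c' - - - ⟨b, h1, h2⟩ ⟨b', h1', h2'⟩
    obtain rfl := hf.1.2.2.2 _ _ _ h1 h1'
    exact hg.1.2.2.2 _ _ _ h2 h2'
  · rintro a c c' - - - ⟨b, h1, h2⟩ ⟨b', h1', h2'⟩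
    obtain rfl := hg.2 _ _ _ h2 h2'
    exact hf.2 _ _ _ h1 h1'
  · intro c hc
    obtain ⟨b, hb⟩ := ht c hc
    obtain ⟨a, ha⟩ := hs b (inj_mem hM hg hb).1
    exact ⟨a, (inj_mem hM hf ha).1, b, ha, hb⟩

/-! ### Cardinals -/

theorem card_self (hM : M ⊨ NFUmAC) {c X : M} (h : isCardOf c X) : smem X c := (h.2 X).2 (equip_refl hM X)

theorem card_congr (hM : M ⊨ NFUmAC) {c X Y : M} (h : isCardOf c X) (e : equipollent X Y) : isCardOf c Y :=
  ⟨h.1, fun y => (h.2 y).trans ⟨fun h => equip_trans hM h e,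
    fun h => equip_trans hM h (equip_symm hM e)⟩⟩

/-- `c` is the cardinal of something. -/
def IsC {M : Type} [LNFU.Structure M] (c : M) : Prop := ∃ X, isCardOf c X

theorem card_of_mem (hM : M ⊨ NFUmAC) {c X : M} (h : IsC c) (hX : smem X c) : isCardOf c X := by
  obtain ⟨Y, hY⟩ := h
  exact card_congr hM hY (equip_symm hM ((hY.2 X).1 hX))

theorem card_unique (hM : M ⊨ NFUmAC) {c c' X : M} (h : isCardOf c X) (h' : isCardOf c' X) : c = c' :=
  ext hM h.1 h'.1 fun z => (h.2 z).trans (h'.2 z).symm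

theorem T_isC {t c : M} (h : isTOf t c) : IsC t := by
  obtain ⟨X, Y, -, -, h⟩ := h
  exact ⟨Y, h⟩

theorem singleton_inj {s x y : M} (h : isSingletonOf s x) (h' : isSingletonOf s y) : x = y :=
  (h'.2 x).1 ((h.2 x).2 rfl)

theorem singleton_unique (hM : M ⊨ NFUmAC) {s s' x : M} (h : isSingletonOf s x) (h' : isSingletonOf s' x) : s = s' :=
  ext hM h.1 h'.1 fun z => (h.2 z).trans (h'.2 z).symm

theorem iota_inj (hM : M ⊨ NFUmAC) {f X Y X' Y' : M} (h : isInjFunc f X Y) (hX : isIotaImageOf X' X)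
    (hY : isIotaImageOf Y' Y) :
    ∃ g, isInjFunc g X' Y' ∧ ∀ a b, smem (spair a b) g ↔ (smem a X' ∧ smem b Y' ∧
      ∃ x y, isSingletonOf a x ∧ isSingletonOf b y ∧ smem (spair x y) f) := by
  refine mk_inj hM (k := 1)
    (R := fun a b => ∃ x y, isSingletonOf a x ∧ isSingletonOf b y ∧ smem (spair x y) f)
    (fun ha hb => .ex 0 (.ex 0 (.and (st_singleton 0 ha.w.w TDef.last.w)
      (.and (st_singleton 0 hb.w.w .last) (.mem (.pair TDef.last.w .last) (.const f)))))) ?_ ?_ ?_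
  · intro a ha
    obtain ⟨x, hx, hax⟩ := (hX.2 a).1 ha
    obtain ⟨y, hy⟩ := h.1.2.2.1 x hx
    obtain ⟨b, hb⟩ := ex_singleton hM y
    exact ⟨b, (hY.2 b).2 ⟨y, (inj_mem hM h hy).2, hb⟩, x, y, hax, hb, hy⟩
  · rintro a b b' - - - ⟨x, y, h1, h2, h3⟩ ⟨x', y', h1', h2', h3'⟩
    obtain rfl := singleton_inj h1 h1'
    obtain rfl := h.1.2.2.2 _ _ _ h3 h3'
    exact singleton_unique hM h2 h2'
  · rintro a b b' - - - ⟨x, y, h1, h2, h3⟩ ⟨x', y', h1', h2', h3'⟩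
    obtain rfl := singleton_inj h2 h2'
    obtain rfl := h.2 _ _ _ h3 h3'
    exact singleton_unique hM h1 h1'

theorem iota_equip (hM : M ⊨ NFUmAC) {X Y X' Y' : M} (h : equipollent X Y) (hX : isIotaImageOf X' X)
    (hY : isIotaImageOf Y' Y) : equipollent X' Y' := by
  obtain ⟨f, hf, hs⟩ := h
  obtain ⟨g, hg, key⟩ := iota_inj hM hf hX hY
  refine ⟨g, hg, fun b hb => ?_⟩
  obtain ⟨y, hy, hby⟩ := (hY.2 b).1 hb
  obtain ⟨x, hx⟩ := hs y hy
  obtain ⟨a, ha⟩ := ex_singleton hM x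
  exact ⟨a, (key a b).2 ⟨(hX.2 a).2 ⟨x, (inj_mem hM hf hx).1, ha⟩, hb, x, y, ha, hby, hx⟩⟩

theorem iota_equip_inv (hM : M ⊨ NFUmAC) {X Y X' Y' : M} (h : equipollent X' Y') (hX : isIotaImageOf X' X)
    (hY : isIotaImageOf Y' Y) : equipollent X Y := by
  obtain ⟨f, hf, hs⟩ := h
  refine mk_bij hM (k := 0)
    (R := fun x y => ∃ a b, isSingletonOf a x ∧ isSingletonOf b y ∧ smem (spair a b) f)
    (fun ha hb => .ex 1 (.ex 1 (.and (st_singleton 0 TDef.last.w ha.w.w)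
      (.and (st_singleton 0 .last hb.w.w) (.mem (.pair TDef.last.w .last) (.const f))))))
    ?_ ?_ ?_ ?_
  · intro x hx
    obtain ⟨a, ha⟩ := ex_singleton hM x
    obtain ⟨b, hb⟩ := hf.1.2.2.1 a ((hX.2 a).2 ⟨x, hx, ha⟩)
    obtain ⟨y, hy, hby⟩ := (hY.2 b).1 (inj_mem hM hf hb).2
    exact ⟨y, hy, a, b, ha, hby, hb⟩
  · rintro x y y' - - - ⟨a, b, h1, h2, h3⟩ ⟨a', b', h1', h2', h3'⟩
    obtain rfl := singleton_unique hM h1 h1'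
    obtain rfl := hf.1.2.2.2 _ _ _ h3 h3'
    exact singleton_inj h2 h2'
  · rintro x y y' - - - ⟨a, b, h1, h2, h3⟩ ⟨a', b', h1', h2', h3'⟩
    obtain rfl := singleton_unique hM h2 h2'
    obtain rfl := hf.2 _ _ _ h3 h3'
    exact singleton_inj h1 h1'
  · intro y hy
    obtain ⟨b, hb⟩ := ex_singleton hM y
    obtain ⟨a, ha⟩ := hs b ((hY.2 b).2 ⟨y, hy, hb⟩)
    obtain ⟨x, hx, hax⟩ := (hX.2 a).1 (inj_mem hM hf ha).1
    exact ⟨x, hx, a, b, hax, hb, ha⟩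

/-- `T` computed on any representative. -/
theorem T_card (hM : M ⊨ NFUmAC) {t c X Y : M} (ht : isTOf t c) (hc : isCardOf c X) (hY : isIotaImageOf Y X) :
    isCardOf t Y := by
  obtain ⟨X', Y', h1, h2, h3⟩ := ht
  exact card_congr hM h3 (iota_equip hM ((hc.2 X').1 h1) h2 hY)

theorem T_unique (hM : M ⊨ NFUmAC) {t t' c : M} (hc : IsC c) (h : isTOf t c) (h' : isTOf t' c) : t = t' := by
  obtain ⟨X, hX⟩ := hc
  obtain ⟨Y, hY⟩ := ex_iota hM X
  exact card_unique hM (T_card hM h hX hY) (T_card hM h' hX hY)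

theorem T_inj (hM : M ⊨ NFUmAC) {t c c' : M} (hc : IsC c) (hc' : IsC c') (h : isTOf t c) (h' : isTOf t c') :
    c = c' := by
  obtain ⟨X, hX⟩ := hc
  obtain ⟨Y, hY⟩ := ex_iota hM X
  obtain ⟨X', hX'⟩ := hc'
  obtain ⟨Y', hY'⟩ := ex_iota hM X'
  have h1 := T_card hM h hX hY
  have h2 := T_card hM h' hX' hY'
  have h3 := (h2.2 Y).1 (card_self hM h1)
  exact card_unique hM (card_congr hM hX (iota_equip_inv hM h3 hY hY')) hX'

theorem ex_T (hM : M ⊨ NFUmAC) {c : M} (hc : IsC c) : ∃ t, isTOf t c := by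
  obtain ⟨X, hX⟩ := hc
  obtain ⟨Y, hY⟩ := ex_iota hM X
  obtain ⟨t, ht⟩ := ex_card hM Y
  exact ⟨t, X, Y, card_self hM hX, hY, ht⟩

theorem T_le (hM : M ⊨ NFUmAC) {a b a' b' : M} (ha : IsC a) (hb : IsC b) (h : cardLe a b) (hta : isTOf a' a)
    (htb : isTOf b' b) : cardLe a' b' := by
  obtain ⟨X, Y, f, hX, hY, hf⟩ := h
  obtain ⟨X', hX'⟩ := ex_iota hM X
  obtain ⟨Y', hY'⟩ := ex_iota hM Y
  obtain ⟨g, hg, -⟩ := iota_inj hM hf hX' hY'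
  exact ⟨X', Y', g, card_self hM (T_card hM hta (card_of_mem hM ha hX) hX'),
    card_self hM (T_card hM htb (card_of_mem hM hb hY) hY'), hg⟩

/-! ### Power sets -/

theorem power_equip (hM : M ⊨ NFUmAC) {X Y P Q : M} (h : equipollent X Y) (hP : isPowerSetOf P X)
    (hQ : isPowerSetOf Q Y) : equipollent P Q := by
  obtain ⟨f, hf, hs⟩ := h
  refine mk_bij hM (k := 1)
    (R := fun A B => ∀ x y, smem (spair x y) f → (smem x A ↔ smem y B))
    (fun ha hb => .all 0 (.all 0 (.imp (.mem (.pair TDef.last.w .last) (.const f))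
      (.iff (.mem TDef.last.w ha.w.w) (.mem .last hb.w.w))))) ?_ ?_ ?_ ?_
  · intro A hA
    obtain ⟨B, hB, hB'⟩ := comprehension hM (k := 0) (P := fun y => ∃ x, smem x A ∧ smem (spair x y) f)
      fun h => .ex 0 (.and (.mem .last (.const A)) (.mem (.pair .last h.w) (.const f)))
    refine ⟨B, (hQ.2 B).2 ⟨hB, fun y hy => ?_⟩, fun x y hxy => ?_⟩
    · obtain ⟨x, hx, hxy⟩ := (hB' y).1 hy
      exact (inj_mem hM hf hxy).2
    · rw [hB']
      constructor
      · intro hx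
        exact ⟨x, hx, hxy⟩
      · rintro ⟨x', hx', hxy'⟩
        obtain rfl := hf.2 _ _ _ hxy hxy'
        exact hx'
  · intro A B B' hA hB hB' h h'
    have hB := (hQ.2 B).1 hB
    have hB' := (hQ.2 B').1 hB'
    refine ext hM hB.1 hB'.1 fun y => ⟨fun hy => ?_, fun hy => ?_⟩
    · obtain ⟨x, hx⟩ := hs y (hB.2 y hy)
      exact (h' x y hx).1 ((h x y hx).2 hy)
    · obtain ⟨x, hx⟩ := hs y (hB'.2 y hy)
      exact (h x y hx).1 ((h' x y hx).2 hy)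
  · intro A A' B hA hA' hB h h'
    have hA := (hP.2 A).1 hA
    have hA' := (hP.2 A').1 hA'
    refine ext hM hA.1 hA'.1 fun x => ⟨fun hx => ?_, fun hx => ?_⟩
    · obtain ⟨y, hy⟩ := hf.1.2.2.1 x (hA.2 x hx)
      exact (h' x y hy).2 ((h x y hy).1 hx)
    · obtain ⟨y, hy⟩ := hf.1.2.2.1 x (hA'.2 x hx)
      exact (h x y hy).2 ((h' x y hy).1 hx)
  · intro B hB
    obtain ⟨A, hA, hA'⟩ := comprehension hM (k := 0) (P := fun x => ∃ y, smem y B ∧ smem (spair x y) f)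
      fun h => .ex 0 (.and (.mem .last (.const B)) (.mem (.pair h.w .last) (.const f)))
    refine ⟨A, (hP.2 A).2 ⟨hA, fun x hx => ?_⟩, fun x y hxy => ?_⟩
    · obtain ⟨y, hy, hxy⟩ := (hA' x).1 hx
      exact (inj_mem hM hf hxy).1
    · rw [hA']
      constructor
      · rintro ⟨y', hy', hxy'⟩
        obtain rfl := hf.1.2.2.2 _ _ _ hxy hxy'
        exact hy'
      · intro hy
        exact ⟨y, hy, hxy⟩

theorem iota_ext_inj (hM : M ⊨ NFUmAC) {A A' B : M} (h : isIotaImageOf B A) (h' : isIotaImageOf B A') {x : M}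
    (hx : smem x A) : smem x A' := by
  obtain ⟨s, hs⟩ := ex_singleton hM x
  obtain ⟨y, hy, hsy⟩ := (h'.2 s).1 ((h.2 s).2 ⟨x, hx, hs⟩)
  rwa [singleton_inj hs hsy]

/-- `ι``P(X)` is equipollent to `P(ι``X)`. -/
theorem power_iota (hM : M ⊨ NFUmAC) {X Y P Q P' : M} (hY : isIotaImageOf Y X) (hP : isPowerSetOf P X)
    (hP' : isIotaImageOf P' P) (hQ : isPowerSetOf Q Y) : equipollent P' Q := by
  refine mk_bij hM (k := 2) (R := fun s B => ∃ A, isSingletonOf s A ∧ isIotaImageOf B A)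
    (fun ha hb => .ex 1 (.and (st_singleton 1 ha.w .last) (st_iota 0 hb.w .last))) ?_ ?_ ?_ ?_
  · intro s hs
    obtain ⟨A, hA, hsA⟩ := (hP'.2 s).1 hs
    obtain ⟨B, hB⟩ := ex_iota hM A
    refine ⟨B, (hQ.2 B).2 ⟨hB.1, fun w hw => ?_⟩, A, hsA, hB⟩
    obtain ⟨x, hx, hwx⟩ := (hB.2 w).1 hw
    exact (hY.2 w).2 ⟨x, ((hP.2 A).1 hA).2 x hx, hwx⟩
  · rintro s B B' - - - ⟨A, h1, h2⟩ ⟨A', h1', h2'⟩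
    obtain rfl := singleton_inj h1 h1'
    exact ext hM h2.1 h2'.1 fun z => (h2.2 z).trans (h2'.2 z).symm
  · rintro s s' B hs hs' - ⟨A, h1, h2⟩ ⟨A', h1', h2'⟩
    obtain ⟨C, hC, hsC⟩ := (hP'.2 s).1 hs
    obtain ⟨C', hC', hsC'⟩ := (hP'.2 s').1 hs'
    obtain rfl := singleton_inj h1 hsC
    obtain rfl := singleton_inj h1' hsC'
    obtain rfl := ext hM ((hP.2 _).1 hC).1 ((hP.2 _).1 hC').1 fun z =>
      ⟨fun hz => iota_ext_inj hM h2 h2' hz, fun hz => iota_ext_inj hM h2' h2 hz⟩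
    exact singleton_unique hM h1 h1'
  · intro B hB
    have hB := (hQ.2 B).1 hB
    obtain ⟨A, hA, hA'⟩ := comprehension hM (k := 0)
      (P := fun x => ∃ s, isSingletonOf s x ∧ smem s B) fun h =>
      .ex 1 (.and (st_singleton 0 .last h.w) (.mem .last (.const B)))
    obtain ⟨s, hs⟩ := ex_singleton hM A
    refine ⟨s, (hP'.2 s).2 ⟨A, (hP.2 A).2 ⟨hA, fun x hx => ?_⟩, hs⟩, A, hs, hB.1, fun z => ?_⟩
    · obtain ⟨s, h1, h2⟩ := (hA' x).1 hx
      obtain ⟨y, hy, h3⟩ := (hY.2 s).1 (hB.2 s h2)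
      rwa [singleton_inj h1 h3]
    · constructor
      · intro hz
        obtain ⟨y, hy, h3⟩ := (hY.2 z).1 (hB.2 z hz)
        exact ⟨y, (hA' y).2 ⟨z, h3, hz⟩, h3⟩
      · rintro ⟨x, hx, h⟩
        obtain ⟨s, h1, h2⟩ := (hA' x).1 hx
        rwa [singleton_unique hM h h1]

end Strat2

end NFUweak
namespace NFUweak

section Strat3

variable {M : Type} [LNFU.Structure M]

/-! ### Adding and removing a point -/

theorem add_point (hM : M ⊨ NFUmAC) {y z d u w e : M} (hz : smem z y) (hd : ∀ x, smem x d ↔ (smem x y ∧ x ≠ z))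
    (hw : smem w u) (he : ∀ x, smem x e ↔ (smem x u ∧ x ≠ w)) (h : equipollent d e) :
    equipollent y u := by
  obtain ⟨f, hf, hs⟩ := h
  have m1 : ∀ {a b}, smem (spair a b) f → (smem a y ∧ a ≠ z) ∧ (smem b u ∧ b ≠ w) := by
    intro a b hab
    have := inj_mem hM hf hab
    exact ⟨(hd a).1 this.1, (he b).1 this.2⟩
  refine mk_bij hM (k := 0) (R := fun a b => (a = z ∧ b = w) ∨ smem (spair a b) f)
    (fun ha hb => .or (.and (.eq ha (.const z)) (.eq hb (.const w)))
      (.mem (.pair ha hb) (.const f))) ?_ ?_ ?_ ?_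
  · intro a ha
    by_cases haz : a = z
    · exact ⟨w, hw, Or.inl ⟨haz, rfl⟩⟩
    · obtain ⟨b, hb⟩ := hf.1.2.2.1 a ((hd a).2 ⟨ha, haz⟩)
      exact ⟨b, (m1 hb).2.1, Or.inr hb⟩
  · rintro a b b' - - - (⟨h1, h2⟩ | h1) (⟨h1', h2'⟩ | h1')
    · exact h2.trans h2'.symm
    · exact absurd h1 (m1 h1').1.2
    · exact absurd h1' (m1 h1).1.2
    · exact hf.1.2.2.2 _ _ _ h1 h1'
  · rintro a b b' - - - (⟨h1, h2⟩ | h1) (⟨h1', h2'⟩ | h1')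
    · exact h1.trans h1'.symm
    · exact absurd h2 (m1 h1').2.2
    · exact absurd h2' (m1 h1).2.2
    · exact hf.2 _ _ _ h1 h1'
  · intro b hb
    by_cases hbw : b = w
    · exact ⟨z, hz, Or.inl ⟨rfl, hbw⟩⟩
    · obtain ⟨a, ha⟩ := hs b ((he b).2 ⟨hb, hbw⟩)
      exact ⟨a, (m1 ha).1.1, Or.inr ha⟩

theorem remove_point (hM : M ⊨ NFUmAC) {y u w e : M} (hw : smem w u) (he : ∀ x, smem x e ↔ (smem x u ∧ x ≠ w))
    (h : equipollent y u) :
    ∃ z, smem z y ∧ ∃ d, sset d ∧ (∀ x, smem x d ↔ (smem x y ∧ x ≠ z)) ∧ equipollent d e := by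
  obtain ⟨f, hf, hs⟩ := h
  obtain ⟨z, hz⟩ := hs w hw
  obtain ⟨d, hds, hd⟩ := ex_diff hM y z
  refine ⟨z, (inj_mem hM hf hz).1, d, hds, hd, ?_⟩
  refine mk_bij hM (k := 0) (R := fun a b => smem (spair a b) f)
    (fun ha hb => .mem (.pair ha hb) (.const f)) ?_ ?_ ?_ ?_
  · intro a ha
    have ha := (hd a).1 ha
    obtain ⟨b, hb⟩ := hf.1.2.2.1 a ha.1
    refine ⟨b, (he b).2 ⟨(inj_mem hM hf hb).2, ?_⟩, hb⟩
    rintro rfl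
    exact ha.2 (hf.2 _ _ _ hb hz)
  · intro a b b' _ _ _ h h'
    exact hf.1.2.2.2 _ _ _ h h'
  · intro a b b' _ _ _ h h'
    exact hf.2 _ _ _ h h'
  · intro b hb
    have hb := (he b).1 hb
    obtain ⟨a, ha⟩ := hs b hb.1
    refine ⟨a, (hd a).2 ⟨(inj_mem hM hf ha).1, ?_⟩, ha⟩
    rintro rfl
    exact hb.2 (hf.1.2.2.2 _ _ _ ha hz)

/-! ### Natural numbers are cardinals -/

theorem zero_card (hM : M ⊨ NFUmAC) {z e : M} (hz : isZeroCard z) (he : ∀ w, ¬ smem w e) : isCardOf z e := by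
  refine ⟨hz.1, fun y => (hz.2 y).trans ⟨fun hy => ?_, fun hy w hw => ?_⟩⟩
  · exact equip_of_ext hM fun x => ⟨fun h => absurd h (hy x), fun h => absurd h (he x)⟩
  · obtain ⟨f, hf, -⟩ := hy
    obtain ⟨b, hb⟩ := hf.1.2.2.1 w hw
    exact he b (inj_mem hM hf hb).2

theorem ex_two (hM : M ⊨ NFUmAC) [Nonempty M] : ∃ p q : M, p ≠ q := by
  obtain ⟨e, -, he⟩ := comprehension hM (k := 0) (P := fun _ : M => False) fun _ => .fal
  obtain ⟨v, -, hv⟩ := comprehension hM (k := 0) (P := fun _ : M => ¬ False) fun _ => .not .fal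
  refine ⟨e, v, ?_⟩
  rintro rfl
  exact (he e).1 ((hv e).2 id)

/-- Any set is equipollent to one which misses some point. -/
theorem ex_small (hM : M ⊨ NFUmAC) [Nonempty M] (X : M) : ∃ X' r, equipollent X X' ∧ ¬ smem r X' := by
  obtain ⟨p, q, hpq⟩ := ex_two hM
  obtain ⟨X', -, hX'⟩ := comprehension hM (k := 0) (P := fun y => ∃ x, smem x X ∧ y = spair x p)
    fun h => .ex 0 (.and (.mem .last (.const X)) (.eq h.w (.pair .last (.const p))))
  refine ⟨X', spair p q, ?_, ?_⟩
  · refine mk_bij hM (k := 0) (R := fun a b => b = spair a p)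
      (fun ha hb => .eq hb (.pair ha (.const p))) ?_ ?_ ?_ ?_
    · intro a ha
      exact ⟨_, (hX' _).2 ⟨a, ha, rfl⟩, rfl⟩
    · rintro a b b' - - - rfl rfl
      rfl
    · rintro a a' b - - - rfl h
      exact (spair_inj hM h).1
    · intro b hb
      exact (hX' b).1 hb
  · intro h
    obtain ⟨x, -, hx⟩ := (hX' _).1 h
    exact hpq (spair_inj hM hx).2.symm

theorem succ_card (hM : M ⊨ NFUmAC) {a b U r d : M} (ha : isCardOf a d) (hb : isSuccOf b a) (hr : smem r U)
    (hd : ∀ x, smem x d ↔ (smem x U ∧ x ≠ r)) : isCardOf b U := by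
  refine ⟨hb.1, fun y => (hb.2 y).trans ⟨?_, fun h => ?_⟩⟩
  · rintro ⟨z, hz, e, -, he, hea⟩
    exact add_point hM hz he hr hd ((ha.2 e).1 hea)
  · obtain ⟨z, hz, e, hes, he, hed⟩ := remove_point hM hr hd h
    exact ⟨z, hz, e, hes, he, (ha.2 e).2 hed⟩

theorem nat_isC (hM : M ⊨ NFUmAC) [Nonempty M] {n : M} (hn : isNat n) : IsC n := by
  refine nat_induction hM (k := 2) (P := IsC) (fun h => .ex 1 (st_card 0 h.w .last)) ?_ ?_ hn
  · intro z hz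
    obtain ⟨e, -, he⟩ := comprehension hM (k := 0) (P := fun _ : M => False) fun _ => .fal
    exact ⟨e, zero_card hM hz fun w hw => (he w).1 hw⟩
  · rintro a b - ⟨X, hX⟩ hb
    obtain ⟨X', r, hXX', hr⟩ := ex_small hM X
    obtain ⟨U, -, hU⟩ := ex_insert hM X' r
    refine ⟨U, succ_card hM (card_congr hM hX hXX') hb ((hU r).2 (Or.inr rfl)) fun x => ?_⟩
    rw [hU]
    constructor
    · intro hx
      refine ⟨Or.inl hx, ?_⟩
      rintro rfl
      exact hr hx
    · rintro ⟨hx | hx, hne⟩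
      · exact hx
      · exact absurd hx hne

/-! ### The operation `T` on natural numbers -/

theorem T_zero (hM : M ⊨ NFUmAC) {z : M} (hz : isZeroCard z) : isTOf z z := by
  obtain ⟨e, -, he⟩ := comprehension hM (k := 0) (P := fun _ : M => False) fun _ => .fal
  obtain ⟨Y, hY⟩ := ex_iota hM e
  refine ⟨e, Y, (hz.2 e).2 fun w hw => (he w).1 hw, hY, zero_card hM hz fun w hw => ?_⟩
  obtain ⟨x, hx, -⟩ := (hY.2 w).1 hw
  exact (he x).1 hx

theorem T_succ (hM : M ⊨ NFUmAC) [Nonempty M] {k k' t t' : M} (hk : isNat k) (ht : isTOf t k) (hk' : isSuccOf k' k)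
    (ht' : isSuccOf t' t) : isTOf t' k' := by
  obtain ⟨U, hU⟩ := nat_isC hM (nat_succ hk hk')
  have hUk := card_self hM hU
  obtain ⟨z, hz, d, hds, hd, hdk⟩ := (hk'.2 U).1 hUk
  obtain ⟨d', hd'⟩ := ex_iota hM d
  obtain ⟨U', hU'⟩ := ex_iota hM U
  obtain ⟨s, hs⟩ := ex_singleton hM z
  have h1 := T_card hM ht (card_of_mem hM (nat_isC hM hk) hdk) hd'
  refine ⟨U, U', hUk, hU', succ_card hM h1 ht' ((hU'.2 s).2 ⟨z, hz, hs⟩) fun x => ?_⟩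
  rw [hd'.2, hU'.2]
  constructor
  · rintro ⟨w, hw, hxw⟩
    have hw := (hd w).1 hw
    refine ⟨⟨w, hw.1, hxw⟩, ?_⟩
    rintro rfl
    exact hw.2 (singleton_inj hxw hs)
  · rintro ⟨⟨w, hw, hxw⟩, hne⟩
    refine ⟨w, (hd w).2 ⟨hw, ?_⟩, hxw⟩
    rintro rfl
    exact hne (singleton_unique hM hxw hs)

theorem T_nat (hM : M ⊨ NFUmAC) [Nonempty M] {k : M} (hk : isNat k) : ∃ t, isTOf t k ∧ isNat t := by
  refine nat_induction hM (k := 2) (P := fun k => ∃ t, isTOf t k ∧ isNat t)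
    (fun h => .ex 3 (.and (st_T 0 .last h.w) (st_nat 1 .last))) ?_ ?_ hk
  · intro z hz
    exact ⟨z, T_zero hM hz, nat_zero hz⟩
  · rintro a b ha ⟨t, ht, htn⟩ hb
    obtain ⟨t', ht'⟩ := ex_succ hM t
    exact ⟨t', T_succ hM ha ht hb ht', nat_succ htn ht'⟩

theorem T_surj (hM : M ⊨ NFUmAC) [Nonempty M] {t : M} (ht : isNat t) : ∃ k, isTOf t k ∧ isNat k := by
  refine nat_induction hM (k := 3) (P := fun t => ∃ k, isTOf t k ∧ isNat k)
    (fun h => .ex 2 (.and (st_T 0 h.w .last) (st_nat 0 .last))) ?_ ?_ ht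
  · intro z hz
    exact ⟨z, T_zero hM hz, nat_zero hz⟩
  · rintro a b ha ⟨k, hk, hkn⟩ hb
    obtain ⟨k', hk'⟩ := ex_succ hM k
    exact ⟨k', T_succ hM hkn hk hk' hb, nat_succ hkn hk'⟩

/-- `T(ℵ₀) = ℵ₀`. -/
theorem T_aleph (hM : M ⊨ NFUmAC) [Nonempty M] {N N' : M} (hN : isNatSet N) (hN' : isIotaImageOf N' N) :
    equipollent N' N := by
  refine mk_bij hM (k := 3) (R := fun s n => ∃ m, isNat m ∧ isSingletonOf s m ∧ isTOf n m)
    (fun ha hb => .ex 2 (.and (st_nat 0 .last) (.and (st_singleton 2 ha.w .last)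
      (st_T 0 hb.w .last)))) ?_ ?_ ?_ ?_
  · intro s hs
    obtain ⟨m, hm, hsm⟩ := (hN'.2 s).1 hs
    have hm := (hN.2 m).1 hm
    obtain ⟨t, ht, htn⟩ := T_nat hM hm
    exact ⟨t, (hN.2 t).2 htn, m, hm, hsm, ht⟩
  · rintro s n n' - - - ⟨m, h1, h2, h3⟩ ⟨m', h1', h2', h3'⟩
    obtain rfl := singleton_inj h2 h2'
    exact T_unique hM (nat_isC hM h1) h3 h3'
  · rintro s s' n - - - ⟨m, h1, h2, h3⟩ ⟨m', h1', h2', h3'⟩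
    obtain rfl := T_inj hM (nat_isC hM h1) (nat_isC hM h1') h3 h3'
    exact singleton_unique hM h2 h2'
  · intro n hn
    obtain ⟨k, hk, hkn⟩ := T_surj hM ((hN.2 n).1 hn)
    obtain ⟨s, hs⟩ := ex_singleton hM k
    exact ⟨s, (hN'.2 s).2 ⟨k, (hN.2 k).2 hkn, hs⟩, k, hkn, hs, hk⟩

theorem not_empty_of_mem {y x : M} (h : smem x y) : ¬ isEmptySet y := fun h' => h'.2 x h

theorem not_empty_of_isC (hM : M ⊨ NFUmAC) {y : M} (h : IsC y) : ¬ isEmptySet y := by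
  obtain ⟨X, hX⟩ := h
  exact not_empty_of_mem (card_self hM hX)

/-! ### `beth` commutes with `T` -/

theorem beth_T (hM : M ⊨ NFUmAC) [Nonempty M] {f : M} (hf : isBethFun f) {k : M} (hk : isNat k) :
    ∀ y, smem (spair k y) f → ¬ isEmptySet y →
      IsC y ∧ ∃ tk ty, isTOf tk k ∧ isTOf ty y ∧ isNat tk ∧ smem (spair tk ty) f := by
  obtain ⟨-, -, hex, hfn, h0, hS⟩ := hf
  refine nat_induction hM (k := 2) (P := fun k => ∀ y, smem (spair k y) f → ¬ isEmptySet y →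
      IsC y ∧ ∃ tk ty, isTOf tk k ∧ isTOf ty y ∧ isNat tk ∧ smem (spair tk ty) f)
    (fun h => .all 2 (.imp (.mem (.pair h.w .last) (.const f)) (.imp (.not (st_empty 1 .last))
      (.and (.ex 1 (st_card 0 TDef.last.w .last))
        (.ex 3 (.ex 3 (.and (st_T 0 TDef.last.w h.w.w.w) (.and (st_T 0 .last TDef.last.w.w)
          (.and (st_nat 1 TDef.last.w)
            (.mem (.pair TDef.last.w .last) (.const f)))))))))))
    ?_ ?_ hk
  · intro z hz y hy _
    obtain ⟨N, hN, hyN⟩ := h0 z y hz hy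
    obtain ⟨N', hN'⟩ := ex_iota hM N
    refine ⟨⟨N, hyN⟩, z, y, T_zero hM hz, ⟨N, N', card_self hM hyN, hN', ?_⟩, nat_zero hz, hy⟩
    exact card_congr hM hyN (equip_symm hM (T_aleph hM hN hN'))
  · intro k k' hk ih hk' y' hy' hne'
    obtain ⟨y, hy⟩ := hex k hk
    rcases hS k k' y y' hk hk' hy hy' with ⟨-, h⟩ | ⟨hne, h | ⟨h, -⟩⟩
    · exact absurd h hne'
    · obtain ⟨-, tk, ty, htk, hty, htkn, htf⟩ := ih y hy hne
      obtain ⟨X, Y, P, hYX, hyY, hPX, hyP⟩ := h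
      refine ⟨⟨P, hyP⟩, ?_⟩
      obtain ⟨tk', htk'⟩ := ex_succ hM tk
      have hn' := nat_succ htkn htk'
      obtain ⟨z, hz⟩ := hex tk' hn'
      obtain ⟨Y', hY'⟩ := ex_iota hM Y
      have htyY : isCardOf ty Y' := T_card hM hty hyY hY'
      have hzp : isTwoPowOf z ty := by
        rcases hS tk tk' ty z htkn htk' htf hz with ⟨h, -⟩ | ⟨-, h | ⟨-, h⟩⟩
        · exact absurd h (not_empty_of_isC hM ⟨_, htyY⟩)
        · exact h
        · exact absurd ⟨Y, Y', hY', htyY⟩ h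
      obtain ⟨X2, Y2, P2, hY2, htyY2, hP2, hzP2⟩ := hzp
      have e1 : equipollent X2 Y :=
        iota_equip_inv hM ((htyY.2 Y2).1 (card_self hM htyY2)) hY2 hY'
      obtain ⟨Q, hQ⟩ := ex_power hM Y
      obtain ⟨P', hP'⟩ := ex_iota hM P
      have e2 := power_equip hM e1 hP2 hQ
      have e3 := power_iota hM hYX hPX hP' hQ
      exact ⟨tk', z, T_succ hM hk htk hk' htk', ⟨P, P', card_self hM hyP, hP',
        card_congr hM hzP2 (equip_trans hM e2 (equip_symm hM e3))⟩, hn', hz⟩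
    · exact absurd h hne'

/-- There is a natural number moved by `T` at which `beth` is defined. -/
theorem ex_moved (hM : M ⊨ NFUmAC) [Nonempty M] {f : M} (hf : isBethFun f) (hA : ¬ axCountHolds M) :
    ∃ k y t : M, isNat k ∧ smem (spair k y) f ∧ ¬ isEmptySet y ∧ isTOf t k ∧ t ≠ k := by
  have hf' := hf
  obtain ⟨-, -, hex, hfn, h0, hS⟩ := hf'
  by_contra hcon
  push Not at hcon
  apply hA
  intro n hn t ht
  have : ∃ y, smem (spair n y) f ∧ ¬ isEmptySet y := by
    refine nat_induction hM (k := 1) (P := fun n => ∃ y, smem (spair n y) f ∧ ¬ isEmptySet y)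
      (fun h => .ex 1 (.and (.mem (.pair h.w .last) (.const f)) (.not (st_empty 0 .last)))) ?_ ?_ hn
    · intro z hz
      obtain ⟨y, hy⟩ := hex z (nat_zero hz)
      obtain ⟨N, -, hN⟩ := h0 z y hz hy
      exact ⟨y, hy, not_empty_of_isC hM ⟨N, hN⟩⟩
    · rintro k k' hk ⟨y, hy, hne⟩ hk'
      obtain ⟨y', hy'⟩ := hex k' (nat_succ hk hk')
      refine ⟨y', hy', ?_⟩
      rcases hS k k' y y' hk hk' hy hy' with ⟨h, -⟩ | ⟨-, h | ⟨-, h⟩⟩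
      · exact absurd h hne
      · obtain ⟨_, _, P, -, -, -, hP⟩ := h
        exact not_empty_of_isC hM ⟨P, hP⟩
      · exfalso
        obtain ⟨-, tk, ty, htk, hty, -, htf⟩ := beth_T hM hf hk y hy hne
        obtain rfl := hcon k y tk hk hy hne htk
        obtain rfl := hfn _ _ _ htf hy
        obtain ⟨X, Y, -, h1, h2⟩ := hty
        exact h ⟨X, Y, h1, h2⟩
  obtain ⟨y, hy, hne⟩ := this
  exact hcon n y t hn hy hne ht

/-- One application of `T` to a witness. -/
theorem step_T (hM : M ⊨ NFUmAC) [Nonempty M] {f : M} (hf : isBethFun f) {k y t c c' : M} (hk : isNat k)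
    (hy : smem (spair k y) f) (hne : ¬ isEmptySet y) (ht : isTOf t k) (htk : t ≠ k)
    (hc : IsC c) (hle : cardLe y c) (hc' : isTOf c' c) :
    ∃ k' y' t' : M, isNat k' ∧ smem (spair k' y') f ∧ ¬ isEmptySet y' ∧ isTOf t' k' ∧ t' ≠ k' ∧
      cardLe y' c' := by
  obtain ⟨hyc, tk, ty, htk', hty, hn, htf⟩ := beth_T hM hf hk y hy hne
  obtain rfl := T_unique hM (nat_isC hM hk) ht htk'
  obtain ⟨t', ht'⟩ := ex_T hM (nat_isC hM hn)
  refine ⟨t, ty, t', hn, htf, not_empty_of_isC hM (T_isC hty), ht', ?_,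
    T_le hM hyc hc hle hty hc'⟩
  rintro rfl
  exact htk (T_inj hM (nat_isC hM hn) (nat_isC hM hk) ht' ht)

theorem le_univ (hM : M ⊨ NFUmAC) {y v c : M} (hy : IsC y) (hv : isUniverseOf v) (hc : isCardOf c v) :
    cardLe y c := by
  obtain ⟨X, hX⟩ := hy
  obtain ⟨g, hg, -⟩ := mk_inj hM (k := 0) (R := fun a b => a = b) (X := X) (Y := v)
    (fun ha hb => .eq ha hb)
    (fun a _ => ⟨a, hv.2 a, rfl⟩) (fun a b b' _ _ _ h h' => h.symm.trans h')
    (fun a b b' _ _ _ h h' => h.trans h'.symm)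
  exact ⟨X, v, g, card_self hM hX, card_self hM hc, hg⟩

end Strat3

theorem stmt14 :
    ∀ (M : Type) [LNFU.Structure M] [Nonempty M], M ⊨ NFUmAC →
      axCountGeqHolds M → ¬ axCountHolds M →
      ∀ f v c t4 : M, isBethFun f → isUniverseOf v → isCardOf c v → isT4Of t4 c →
        ∃ n y t : M, isNat n ∧ isTOf t n ∧ natLe t n ∧ t ≠ n ∧
          smem (spair n y) f ∧ ¬ isEmptySet y ∧ cardLe y t4 := by
  intro M _ _ hM hge hA f v c t4 hf hv hc ht4
  obtain ⟨c1, c2, c3, h1, h2, h3, h4⟩ := ht4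
  obtain ⟨k, y, t, hk, hy, hne, ht, htk⟩ := ex_moved hM hf hA
  have hyc := (beth_T hM hf hk y hy hne).1
  obtain ⟨k1, y1, t1, a1, b1, d1, e1, g1, i1⟩ :=
    step_T hM hf hk hy hne ht htk ⟨v, hc⟩ (le_univ hM hyc hv hc) h1
  obtain ⟨k2, y2, t2, a2, b2, d2, e2, g2, i2⟩ := step_T hM hf a1 b1 d1 e1 g1 (T_isC h1) i1 h2
  obtain ⟨k3, y3, t3, a3, b3, d3, e3, g3, i3⟩ := step_T hM hf a2 b2 d2 e2 g2 (T_isC h2) i2 h3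
  obtain ⟨k4, y4, t4', a4, b4, d4, e4, g4, i4⟩ := step_T hM hf a3 b3 d3 e3 g3 (T_isC h3) i3 h4
  exact ⟨k4, y4, t4', a4, e4, hge k4 a4 t4' e4, g4, b4, d4, i4⟩

end NFUweak
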